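/- For every finite projective plane Π of order q, the number of ordered 7-arcs satisfies, as an inequality of integers, C_7(Π) ≤ (q^2 + q + 1)(q^2 + q)q^2(q - 1)^2(q - 3)(q - 5)(q^4 - 20q^3 + 148q^2 - 468q + 498). -/

import Mathlib

open scoped Classical

structure ProjPlane (q : ℕ) where
  Point : Type
  fintypePoint : Fintype Point
  L : Set (Set Point)
  unique_line : ∀ p₁ p₂ : Point, p₁ ≠ p₂ → ∃! ℓ, ℓ ∈ L ∧ p₁ ∈ ℓ ∧ p₂ ∈ ℓ
  unique_point : ∀ ℓ₁ ℓ₂, ℓ₁ ∈ L → ℓ₂ ∈ L → ℓ₁ ≠ ℓ₂ → ∃! p, p ∈ ℓ₁ ∧ p ∈ ℓ₂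
  nondegenerate : ∃ a b c d : Point, a ≠ b ∧ a ≠ c ∧ a ≠ d ∧ b ≠ c ∧ b ≠ d ∧ c ≠ d ∧
    ∀ ℓ ∈ L, ¬({a, b, c} ⊆ ℓ) ∧ ¬({a, b, d} ⊆ ℓ) ∧ ¬({a, c, d} ⊆ ℓ) ∧ ¬({b, c, d} ⊆ ℓ)
  line_card : ∀ ℓ ∈ L, ℓ.ncard = q + 1
  point_card : ∀ p : Point, {ℓ ∈ L | p ∈ ℓ}.ncard = q + 1

/-- A set of points is collinear if it is contained in a line. -/
noncomputable def ProjPlane.Collinear {q : ℕ} (Pl : ProjPlane q) (s : Set Pl.Point) : Prop :=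
  ∃ ℓ ∈ Pl.L, s ⊆ ℓ

/-- The number of ordered `n`-arcs of the plane. -/
noncomputable def ProjPlane.nArcs {q : ℕ} (Pl : ProjPlane q) (n : ℕ) : ℕ :=
  Nat.card {p : Fin n → Pl.Point // Function.Injective p ∧
    ∀ i j k : Fin n, i ≠ j → i ≠ k → j ≠ k → ¬ Pl.Collinear {p i, p j, p k}}

/-- Number of ordered strong realizations of the Fano plane. -/
noncomputable def ProjPlane.A7 {q : ℕ} (Pl : ProjPlane q) : ℕ :=
  Nat.card {p : ZMod 7 → Pl.Point // Function.Injective p ∧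
    ∃ σ : Equiv.Perm (ZMod 7), ∀ i j k : ZMod 7, i ≠ j → i ≠ k → j ≠ k →
      (Pl.Collinear {p (σ i), p (σ j), p (σ k)} ↔
        ∃ a : ZMod 7, ({i, j, k} : Set (ZMod 7)) = {a, a + 1, a + 3})}

/-- Number of ordered strong realizations of the Möbius–Kantor configuration. -/
noncomputable def ProjPlane.A8 {q : ℕ} (Pl : ProjPlane q) : ℕ :=
  Nat.card {p : ZMod 8 → Pl.Point // Function.Injective p ∧
    ∃ σ : Equiv.Perm (ZMod 8), ∀ i j k : ZMod 8, i ≠ j → i ≠ k → j ≠ k →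
      (Pl.Collinear {p (σ i), p (σ j), p (σ k)} ↔
        ∃ a : ZMod 8, ({i, j, k} : Set (ZMod 8)) = {a, a + 1, a + 3})}

namespace ProjPlane

variable {q : ℕ} (Pl : ProjPlane q)

instance : Fintype Pl.Point := Pl.fintypePoint

/-- The line through two points (junk if they are equal). -/
noncomputable def join (a b : Pl.Point) : Set Pl.Point :=
  if h : a ≠ b then (Pl.unique_line a b h).choose else ∅

variable {Pl}

lemma join_spec {a b : Pl.Point} (h : a ≠ b) :
    Pl.join a b ∈ Pl.L ∧ a ∈ Pl.join a b ∧ b ∈ Pl.join a b := by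
  rw [join, dif_pos h]
  exact (Pl.unique_line a b h).choose_spec.1

lemma eq_of_mem {a b : Pl.Point} (h : a ≠ b) {ℓ m : Set Pl.Point} (hℓ : ℓ ∈ Pl.L) (hm : m ∈ Pl.L)
    (h1 : a ∈ ℓ) (h2 : b ∈ ℓ) (h3 : a ∈ m) (h4 : b ∈ m) : ℓ = m :=
  (Pl.unique_line a b h).unique ⟨hℓ, h1, h2⟩ ⟨hm, h3, h4⟩

lemma eq_join {a b : Pl.Point} (h : a ≠ b) {ℓ : Set Pl.Point} (hℓ : ℓ ∈ Pl.L)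
    (h1 : a ∈ ℓ) (h2 : b ∈ ℓ) : ℓ = Pl.join a b :=
  eq_of_mem h hℓ (join_spec h).1 h1 h2 (join_spec h).2.1 (join_spec h).2.2

lemma join_comm (a b : Pl.Point) : Pl.join a b = Pl.join b a := by
  by_cases h : a = b
  · rw [h]
  · exact eq_join (Ne.symm h) (join_spec h).1 (join_spec h).2.2 (join_spec h).2.1

lemma eq_of_mem_of_mem {ℓ m : Set Pl.Point} (hℓ : ℓ ∈ Pl.L) (hm : m ∈ Pl.L) (h : ℓ ≠ m)
    {x y : Pl.Point} (h1 : x ∈ ℓ) (h2 : x ∈ m) (h3 : y ∈ ℓ) (h4 : y ∈ m) : x = y := by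
  by_contra hxy
  exact h (eq_of_mem hxy hℓ hm h1 h3 h2 h4)

lemma collinear_iff {a b c : Pl.Point} (h : a ≠ b) :
    Pl.Collinear {a, b, c} ↔ c ∈ Pl.join a b := by
  constructor
  · rintro ⟨ℓ, hℓ, hs⟩
    rw [← eq_join h hℓ (hs (by simp)) (hs (by simp))]
    exact hs (by simp)
  · intro hc
    refine ⟨_, (join_spec h).1, ?_⟩
    rintro x (rfl | rfl | rfl)
    exacts [(join_spec h).2.1, (join_spec h).2.2, hc]

lemma card_filter_mem {ℓ : Set Pl.Point} (hℓ : ℓ ∈ Pl.L) :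
    (Finset.univ.filter (· ∈ ℓ)).card = q + 1 := by
  rw [← Pl.line_card ℓ hℓ, ← Set.ncard_coe_finset]
  congr 1
  ext
  simp

variable (Pl) in
lemma card_point : Fintype.card Pl.Point = q ^ 2 + q + 1 := by
  obtain ⟨a, -⟩ := Pl.nondegenerate
  have h1 : (Finset.univ.erase a).card
      = ∑ ℓ ∈ Finset.univ.filter (fun ℓ : Set Pl.Point => ℓ ∈ Pl.L ∧ a ∈ ℓ), q := by
    rw [Finset.card_eq_sum_card_fiberwise (f := fun x => Pl.join a x)
      (t := Finset.univ.filter (fun ℓ : Set Pl.Point => ℓ ∈ Pl.L ∧ a ∈ ℓ))]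
    · refine Finset.sum_congr rfl fun ℓ hℓ => ?_
      simp only [Finset.mem_filter, Finset.mem_univ, true_and] at hℓ
      have : (Finset.univ.erase a).filter (fun x => Pl.join a x = ℓ)
          = (Finset.univ.filter (· ∈ ℓ)).erase a := by
        ext x
        simp only [Finset.mem_filter, Finset.mem_erase, Finset.mem_univ, and_true, true_and]
        refine and_congr_right fun hx => ⟨fun h => ?_, fun h => ?_⟩
        · rw [← h]; exact (join_spec (Ne.symm hx)).2.2
        · exact (eq_join (Ne.symm hx) hℓ.1 hℓ.2 h).symm
      rw [this, Finset.card_erase_of_mem (by simpa using hℓ.2), card_filter_mem hℓ.1]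
      simp
    · intro x hx
      have hx : a ≠ x := by simpa [eq_comm] using hx
      simpa using ⟨(join_spec hx).1, (join_spec hx).2.1⟩
  have h2 : (Finset.univ.filter (fun ℓ : Set Pl.Point => ℓ ∈ Pl.L ∧ a ∈ ℓ)).card = q + 1 := by
    rw [← Pl.point_card a, ← Set.ncard_coe_finset]
    congr 1
    ext
    simp
  rw [Finset.sum_const, h2, Finset.card_erase_of_mem (Finset.mem_univ _), Finset.card_univ] at h1
  have : 0 < Fintype.card Pl.Point := Fintype.card_pos_iff.2 ⟨a⟩
  simp only [smul_eq_mul] at h1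
  have h3 : (q + 1) * q = q ^ 2 + q := by ring
  omega

/-- Ordered arcs, phrased through `join`. -/
def IsArc {n : ℕ} (p : Fin n → Pl.Point) : Prop :=
  Function.Injective p ∧ ∀ i j k, i ≠ j → i ≠ k → j ≠ k → p k ∉ Pl.join (p i) (p j)

variable (Pl) in
/-- The finset of ordered `n`-arcs. -/
noncomputable def arcs (n : ℕ) : Finset (Fin n → Pl.Point) := Finset.univ.filter IsArc

lemma mem_arcs {n : ℕ} {p : Fin n → Pl.Point} : p ∈ Pl.arcs n ↔ IsArc p := by simp [arcs]

lemma nArcs_eq (n : ℕ) : Pl.nArcs n = (Pl.arcs n).card := by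
  rw [nArcs, arcs, ← Fintype.card_subtype, ← Nat.card_eq_fintype_card]
  refine Nat.card_congr (Equiv.subtypeEquivRight fun p => and_congr_right fun hp => ?_)
  refine forall_congr' fun i => forall_congr' fun j => forall_congr' fun k =>
    imp_congr_right fun hij => ?_
  rw [collinear_iff (hp.ne hij)]

lemma isArc_snoc {n : ℕ} {p : Fin n → Pl.Point} (hp : IsArc p) {x : Pl.Point}
    (hx : ∀ i, x ≠ p i) (h : ∀ i j, i < j → x ∉ Pl.join (p i) (p j)) :
    IsArc (Fin.snoc p x : Fin (n + 1) → Pl.Point) := by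
  have h' : ∀ i j, i ≠ j → x ∉ Pl.join (p i) (p j) := by
    intro i j hij
    rcases lt_or_gt_of_ne hij with hl | hl
    · exact h i j hl
    · rw [join_comm]; exact h j i hl
  have key : ∀ i k, p k ∈ Pl.join (p i) x → p i ≠ p k → x ∈ Pl.join (p i) (p k) := by
    intro i k hm hik
    have h1 := join_spec (hx i).symm
    rw [← eq_join hik h1.1 h1.2.1 hm]
    exact h1.2.2
  constructor
  · exact Fin.snoc_injective_iff.2 ⟨hp.1, by rintro ⟨i, hi⟩; exact hx i hi.symm⟩
  · intro i j k
    induction i using Fin.lastCases with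
    | last =>
      induction j using Fin.lastCases with
      | last => simp
      | cast j =>
        induction k using Fin.lastCases with
        | last => simp
        | cast k =>
          intro _ _ hjk
          have hjk : j ≠ k := fun h => hjk (by rw [h])
          simp only [Fin.snoc_last, Fin.snoc_castSucc]
          rw [join_comm]
          exact fun hm => h' j k hjk (key j k hm (hp.1.ne hjk))
    | cast i =>
      induction j using Fin.lastCases with
      | last =>
        induction k using Fin.lastCases with
        | last => simp
        | cast k =>
          intro _ hik _
          have hik : i ≠ k := fun h => hik (by rw [h])
          simp only [Fin.snoc_last, Fin.snoc_castSucc]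
          exact fun hm => h' i k hik (key i k hm (hp.1.ne hik))
      | cast j =>
        induction k using Fin.lastCases with
        | last =>
          intro hij _ _
          have hij : i ≠ j := fun h => hij (by rw [h])
          simpa using h' i j hij
        | cast k =>
          intro hij hik hjk
          simp only [Fin.snoc_castSucc]
          exact hp.2 i j k (fun h => hij (by rw [h])) (fun h => hik (by rw [h]))
            (fun h => hjk (by rw [h]))

lemma IsArc.comp {n m : ℕ} {p : Fin n → Pl.Point} (hp : IsArc p) {f : Fin m → Fin n}
    (hf : Function.Injective f) : IsArc (p ∘ f) :=
  ⟨hp.1.comp hf, fun _ _ _ hij hik hjk => hp.2 _ _ _ (hf.ne hij) (hf.ne hik) (hf.ne hjk)⟩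

lemma isArc_snoc_iff {n : ℕ} {p : Fin n → Pl.Point} (hp : IsArc p) {x : Pl.Point} :
    IsArc (Fin.snoc p x : Fin (n + 1) → Pl.Point) ↔
      (∀ i, x ≠ p i) ∧ ∀ i j, i < j → x ∉ Pl.join (p i) (p j) := by
  refine ⟨fun h => ⟨fun i hi => ?_, fun i j hij => ?_⟩, fun h => isArc_snoc hp h.1 h.2⟩
  · have := h.1 (a₁ := Fin.last n) (a₂ := i.castSucc) (by simpa using hi)
    exact (Fin.castSucc_lt_last i).ne this.symm
  · have := h.2 i.castSucc j.castSucc (Fin.last n) (by simpa using hij.ne)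
      (Fin.castSucc_lt_last i).ne (Fin.castSucc_lt_last j).ne
    simpa using this

lemma card_filter_arcs_succ (n : ℕ) (Q : (Fin (n + 1) → Pl.Point) → Prop) :
    ((Pl.arcs (n + 1)).filter Q).card = ∑ p ∈ Pl.arcs n,
      (Finset.univ.filter fun x => IsArc (Fin.snoc p x : Fin (n + 1) → Pl.Point) ∧
        Q (Fin.snoc p x : Fin (n + 1) → Pl.Point)).card := by
  rw [Finset.card_eq_sum_card_fiberwise (f := fun r : Fin (n + 1) → Pl.Point => Fin.init r)
    (t := Pl.arcs n)]
  · refine Finset.sum_congr rfl fun p _ => ?_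
    refine Finset.card_nbij' (fun r => r (Fin.last n))
      (fun x => (Fin.snoc p x : Fin (n + 1) → Pl.Point)) ?_ ?_ ?_ ?_
    · intro r hr
      simp only [Finset.coe_filter, Set.mem_ofPred_eq, Finset.mem_filter, mem_arcs] at hr
      obtain ⟨⟨h1, h2⟩, rfl⟩ := hr
      simpa using ⟨h1, h2⟩
    · intro x hx
      simp only [Finset.coe_filter, Set.mem_ofPred_eq, Finset.mem_univ, true_and] at hx
      simpa [mem_arcs] using hx
    · intro r hr
      simp only [Finset.coe_filter, Set.mem_ofPred_eq, Finset.mem_filter, mem_arcs] at hr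
      obtain ⟨-, rfl⟩ := hr
      simp
    · intro x _
      simp
  · intro r hr
    simp only [Finset.coe_filter, Set.mem_ofPred_eq, mem_arcs] at hr
    exact mem_arcs.2 (hr.1.comp (Fin.castSucc_injective n))

/-- `x` lies on the secant of `p` spanned by the index pair `e`. -/
def OnSecant {n : ℕ} (p : Fin n → Pl.Point) (e : Finset (Fin n)) (x : Pl.Point) : Prop :=
  ∃ i j, i ≠ j ∧ e = {i, j} ∧ x ∈ Pl.join (p i) (p j)

lemma onSecant_pair {n : ℕ} {p : Fin n → Pl.Point} {i j : Fin n} (hij : i ≠ j) {x : Pl.Point} :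
    OnSecant p {i, j} x ↔ x ∈ Pl.join (p i) (p j) := by
  refine ⟨?_, fun h => ⟨i, j, hij, rfl, h⟩⟩
  rintro ⟨k, l, hkl, he, h⟩
  have hk : k = i ∨ k = j := by
    have : k ∈ ({i, j} : Finset (Fin n)) := he ▸ (by simp)
    simpa using this
  have hl : l = i ∨ l = j := by
    have : l ∈ ({i, j} : Finset (Fin n)) := he ▸ (by simp)
    simpa using this
  rcases hk with rfl | rfl <;> rcases hl with rfl | rfl
  · exact absurd rfl hkl
  · exact h
  · rwa [join_comm]
  · exact absurd rfl hkl

/-- The `k`-element matchings of the complete graph on `Fin n`. -/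
def matchings (n k : ℕ) : Finset (Finset (Finset (Fin n))) :=
  ((Finset.univ.powersetCard 2).powersetCard k).filter
    fun T => ∀ e ∈ T, ∀ f ∈ T, e ≠ f → Disjoint e f

/-- The points off the arc lying on all secants indexed by `T`. -/
noncomputable def common {n : ℕ} (p : Fin n → Pl.Point) (T : Finset (Finset (Fin n))) :
    Finset Pl.Point :=
  Finset.univ.filter fun x => (∀ i, x ≠ p i) ∧ ∀ e ∈ T, OnSecant p e x

/-- The index pairs of the secants through `x`. -/
noncomputable def secants {n : ℕ} (p : Fin n → Pl.Point) (x : Pl.Point) :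
    Finset (Finset (Fin n)) :=
  (Finset.univ.powersetCard 2).filter fun e => OnSecant p e x

lemma disjoint_of_onSecant {n : ℕ} {p : Fin n → Pl.Point} (hp : IsArc p) {x : Pl.Point}
    (hx : ∀ i, x ≠ p i) {e f : Finset (Fin n)} (he : OnSecant p e x) (hf : OnSecant p f x)
    (hef : e ≠ f) : Disjoint e f := by
  rw [Finset.disjoint_left]
  intro i hie hif
  have key : ∀ g : Finset (Fin n), i ∈ g → OnSecant p g x →
      ∃ j, i ≠ j ∧ g = {i, j} ∧ x ∈ Pl.join (p i) (p j) := by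
    rintro g hig ⟨k, l, hkl, rfl, h⟩
    rcases Finset.mem_insert.1 hig with rfl | hil
    · exact ⟨l, hkl, rfl, h⟩
    · rw [Finset.mem_singleton] at hil
      subst hil
      exact ⟨k, hkl.symm, Finset.pair_comm _ _, by rwa [join_comm]⟩
  obtain ⟨j, hij, rfl, hj⟩ := key e hie he
  obtain ⟨k, hik, rfl, hk⟩ := key f hif hf
  have hjk : j ≠ k := fun h => hef (by rw [h])
  have h1 := join_spec (hp.1.ne hij)
  have h2 := join_spec (hp.1.ne hik)
  refine hp.2 i j k hij hik hjk ?_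
  rw [eq_of_mem (hx i) h1.1 h2.1 hj h1.2.1 hk h2.2.1]
  exact h2.2.2

lemma two_mul_card_secants_le {n : ℕ} {p : Fin n → Pl.Point} (hp : IsArc p) {x : Pl.Point}
    (hx : ∀ i, x ≠ p i) : 2 * (secants p x).card ≤ n := by
  have h : ((secants p x).biUnion id).card = ∑ e ∈ secants p x, e.card := by
    refine Finset.card_biUnion fun e he f hf hef => ?_
    exact disjoint_of_onSecant hp hx (Finset.mem_filter.1 he).2 (Finset.mem_filter.1 hf).2 hef
  have h2 : ∀ e ∈ secants p x, e.card = 2 := fun e he =>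
    (Finset.mem_powersetCard.1 (Finset.mem_filter.1 he).1).2
  rw [Finset.sum_const_nat h2] at h
  have := Finset.card_le_univ ((secants p x).biUnion id)
  rw [Fintype.card_fin] at this
  omega

lemma sum_choose_card_secants {n : ℕ} {p : Fin n → Pl.Point} (hp : IsArc p) (k : ℕ) :
    ∑ x with ∀ i, x ≠ p i, ((secants p x).card.choose k) =
      ∑ T ∈ matchings n k, (common p T).card := by
  have h := Finset.sum_card_bipartiteAbove_eq_sum_card_bipartiteBelow
    (s := Finset.univ.filter fun x : Pl.Point => ∀ i, x ≠ p i) (t := matchings n k)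
    (fun x T => ∀ e ∈ T, OnSecant p e x)
  refine Eq.trans (Finset.sum_congr rfl fun x hx => ?_)
    (h.trans (Finset.sum_congr rfl fun T _ => ?_))
  · simp only [Finset.mem_filter, Finset.mem_univ, true_and] at hx
    rw [← Finset.card_powersetCard, Finset.bipartiteAbove]
    congr 1
    ext T
    simp only [Finset.mem_powersetCard, matchings, Finset.mem_filter]
    constructor
    · rintro ⟨h1, h2⟩
      refine ⟨⟨⟨h1.trans (Finset.filter_subset _ _), h2⟩, fun e he f hf hef => ?_⟩, fun e he => ?_⟩
      · exact disjoint_of_onSecant hp hx (Finset.mem_filter.1 (h1 he)).2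
          (Finset.mem_filter.1 (h1 hf)).2 hef
      · exact (Finset.mem_filter.1 (h1 he)).2
    · rintro ⟨⟨⟨h1, h2⟩, -⟩, h3⟩
      exact ⟨fun e he => Finset.mem_filter.2 ⟨h1 he, h3 e he⟩, h2⟩
  · rw [Finset.bipartiteBelow, common, Finset.filter_filter]

lemma card_common_empty {n : ℕ} {p : Fin n → Pl.Point} (hp : IsArc p) :
    ((common p ∅).card : ℤ) = q ^ 2 + q + 1 - n := by
  have h : common p ∅ = (Finset.univ.image p)ᶜ := by
    ext x
    simp [common, eq_comm]
  have h1 := Finset.card_add_card_compl (Finset.univ.image p)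
  rw [Finset.card_image_of_injective _ hp.1, card_point, Finset.card_univ, Fintype.card_fin] at h1
  rw [h]
  zify at h1
  linarith

lemma card_common_singleton {n : ℕ} {p : Fin n → Pl.Point} (hp : IsArc p) {e : Finset (Fin n)}
    (he : e.card = 2) : ((common p {e}).card : ℤ) = q - 1 := by
  obtain ⟨i, j, hij, rfl⟩ := Finset.card_eq_two.1 he
  have hl := join_spec (hp.1.ne hij)
  have h : common p {{i, j}} =
      ((Finset.univ.filter (· ∈ Pl.join (p i) (p j))).erase (p i)).erase (p j) := by
    ext x
    simp only [common, Finset.mem_filter, Finset.mem_univ, true_and, Finset.mem_singleton,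
      forall_eq, Finset.mem_erase, onSecant_pair hij]
    constructor
    · rintro ⟨h1, h2⟩
      exact ⟨h1 j, h1 i, h2⟩
    · rintro ⟨h1, h2, h3⟩
      refine ⟨fun k hk => ?_, h3⟩
      subst hk
      exact hp.2 i j k hij (fun h => h2 (by rw [h])) (fun h => h1 (by rw [h])) h3
  rw [h, Finset.card_erase_of_mem, Finset.card_erase_of_mem, card_filter_mem hl.1]
  · have : 2 ≤ q + 1 := by
      rw [← card_filter_mem hl.1, ← Finset.card_pair (hp.1.ne hij)]
      refine Finset.card_le_card ?_
      rintro x hx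
      simp only [Finset.mem_insert, Finset.mem_singleton] at hx
      rcases hx with rfl | rfl
      · simpa using hl.2.1
      · simpa using hl.2.2
    omega
  · simpa using hl.2.1
  · simpa [(hp.1.ne hij).symm] using hl.2.2

lemma IsArc.join_ne {n : ℕ} {p : Fin n → Pl.Point} (hp : IsArc p) {i j k l : Fin n}
    (hij : i ≠ j) (hil : i ≠ l) (hjl : j ≠ l) (hkl : k ≠ l) :
    Pl.join (p i) (p j) ≠ Pl.join (p k) (p l) := by
  intro h
  refine hp.2 i j l hij hil hjl ?_
  rw [h]
  exact (join_spec (hp.1.ne hkl)).2.2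

lemma card_common_pair {n : ℕ} {p : Fin n → Pl.Point} (hp : IsArc p) {e f : Finset (Fin n)}
    (he : e.card = 2) (hf : f.card = 2) (hef : Disjoint e f) : (common p {e, f}).card = 1 := by
  obtain ⟨i, j, hij, rfl⟩ := Finset.card_eq_two.1 he
  obtain ⟨k, l, hkl, rfl⟩ := Finset.card_eq_two.1 hf
  simp only [Finset.disjoint_insert_left, Finset.mem_insert, Finset.mem_singleton,
    Finset.disjoint_singleton_left, not_or] at hef
  obtain ⟨⟨hik, hil⟩, hjk, hjl⟩ := hef
  have h1 := join_spec (hp.1.ne hij)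
  have h2 := join_spec (hp.1.ne hkl)
  have hne := hp.join_ne hij hil hjl hkl
  obtain ⟨x, ⟨hx1, hx2⟩, -⟩ := Pl.unique_point _ _ h1.1 h2.1 hne
  rw [Finset.card_eq_one]
  refine ⟨x, ?_⟩
  ext y
  simp only [common, Finset.mem_filter, Finset.mem_univ, true_and, Finset.mem_singleton,
    forall_eq, Finset.mem_insert, forall_eq_or_imp, onSecant_pair hij, onSecant_pair hkl]
  constructor
  · rintro ⟨-, h3, h4⟩
    exact eq_of_mem_of_mem h1.1 h2.1 hne h3 h4 hx1 hx2
  · rintro rfl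
    refine ⟨fun m hm => ?_, hx1, hx2⟩
    subst hm
    by_cases hmi : i = m
    · subst hmi; exact hp.2 k l i hkl (Ne.symm hik) (Ne.symm hil) hx2
    by_cases hmj : j = m
    · subst hmj; exact hp.2 k l j hkl (Ne.symm hjk) (Ne.symm hjl) hx2
    exact hp.2 i j m hij hmi hmj hx1

lemma card_extensions {n : ℕ} (hn : n ≤ 6) {p : Fin n → Pl.Point} (hp : IsArc p) :
    ((Finset.univ.filter fun x => IsArc (Fin.snoc p x : Fin (n + 1) → Pl.Point)).card : ℤ) =
      (q ^ 2 + q + 1 - n) - n.choose 2 * (q - 1) + (matchings n 2).card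
        - ∑ T ∈ matchings n 3, ((common p T).card : ℤ) := by
  have h0 : ((Finset.univ.filter fun x => IsArc (Fin.snoc p x : Fin (n + 1) → Pl.Point)).card : ℤ)
      = ∑ x with ∀ i, x ≠ p i, (if (secants p x).card = 0 then 1 else 0 : ℤ) := by
    rw [Finset.sum_ite, Finset.sum_const_zero, add_zero, Finset.sum_const, nsmul_eq_mul, mul_one,
      Finset.filter_filter]
    congr 2
    ext x
    simp only [Finset.mem_filter, Finset.mem_univ, true_and, isArc_snoc_iff hp,
      Finset.card_eq_zero]
    refine and_congr_right fun _ => ?_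
    simp only [secants, Finset.filter_eq_empty_iff, Finset.mem_powersetCard_univ]
    constructor
    · rintro h e - ⟨i, j, hij, -, hx⟩
      rcases lt_or_gt_of_ne hij with hl | hl
      · exact h i j hl hx
      · rw [join_comm] at hx; exact h j i hl hx
    · intro h i j hij hx
      exact h (Finset.card_pair hij.ne) ((onSecant_pair hij.ne).2 hx)
  have h1 : ∀ x ∈ Finset.univ.filter (fun x : Pl.Point => ∀ i, x ≠ p i),
      (if (secants p x).card = 0 then 1 else 0 : ℤ) =
        ((secants p x).card.choose 0 : ℕ) - ((secants p x).card.choose 1 : ℕ)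
        + ((secants p x).card.choose 2 : ℕ) - ((secants p x).card.choose 3 : ℕ) := by
    intro x hx
    have := two_mul_card_secants_le hp (x := x) (by simpa using hx)
    generalize (secants p x).card = m at *
    have : m ≤ 3 := by omega
    interval_cases m <;> decide
  rw [h0, Finset.sum_congr rfl h1, Finset.sum_sub_distrib, Finset.sum_add_distrib,
    Finset.sum_sub_distrib]
  simp only [← Nat.cast_sum]
  rw [sum_choose_card_secants hp, sum_choose_card_secants hp, sum_choose_card_secants hp,
    sum_choose_card_secants hp]
  push_cast
  have e0 : ∑ T ∈ matchings n 0, ((common p T).card : ℤ) = q ^ 2 + q + 1 - n := by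
    have : matchings n 0 = {∅} := by
      ext T
      simp only [matchings, Finset.powersetCard_zero, Finset.mem_filter, Finset.mem_singleton,
        and_iff_left_iff_imp]
      rintro rfl
      simp
    rw [this, Finset.sum_singleton, card_common_empty hp]
  have e1 : ∑ T ∈ matchings n 1, ((common p T).card : ℤ) = n.choose 2 * (q - 1) := by
    have hc : (matchings n 1).card = n.choose 2 := by
      have : matchings n 1 = (Finset.univ.powersetCard 2).powersetCard 1 := by
        refine Finset.filter_true_of_mem fun T hT e he f hf hef => ?_
        obtain ⟨g, rfl⟩ := Finset.card_eq_one.1 (Finset.mem_powersetCard.1 hT).2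
        rw [Finset.mem_singleton] at he hf
        exact absurd (he.trans hf.symm) hef
      rw [this]
      simp
    rw [← hc, ← nsmul_eq_mul]
    refine Finset.sum_eq_card_nsmul fun T hT => ?_
    have hT := Finset.mem_powersetCard.1 (Finset.mem_filter.1 hT).1
    obtain ⟨g, rfl⟩ := Finset.card_eq_one.1 hT.2
    exact card_common_singleton hp (Finset.mem_powersetCard.1 (hT.1 (by simp))).2
  have e2 : ∑ T ∈ matchings n 2, ((common p T).card : ℤ) = (matchings n 2).card := by
    rw [← mul_one ((matchings n 2).card : ℤ), ← nsmul_eq_mul]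
    refine Finset.sum_eq_card_nsmul fun T hT => ?_
    obtain ⟨hT, hd⟩ := Finset.mem_filter.1 hT
    have hT := Finset.mem_powersetCard.1 hT
    obtain ⟨e, f, hef, rfl⟩ := Finset.card_eq_two.1 hT.2
    rw [card_common_pair hp (Finset.mem_powersetCard.1 (hT.1 (by simp))).2
      (Finset.mem_powersetCard.1 (hT.1 (by simp))).2 (hd e (by simp) f (by simp) hef)]
    rfl
  rw [e0, e1, e2]

lemma card_arcs_succ {n : ℕ} (hn : n ≤ 6) :
    ((Pl.arcs (n + 1)).card : ℤ) = (Pl.arcs n).card *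
      ((q ^ 2 + q + 1 - n) - n.choose 2 * (q - 1) + (matchings n 2).card)
        - ∑ T ∈ matchings n 3, ∑ p ∈ Pl.arcs n, ((common p T).card : ℤ) := by
  have h := card_filter_arcs_succ (Pl := Pl) n (fun _ => True)
  simp only [Finset.filter_true, and_true] at h
  rw [h, Nat.cast_sum, Finset.sum_congr rfl fun p hp => card_extensions hn (mem_arcs.1 hp),
    Finset.sum_sub_distrib, Finset.sum_const, nsmul_eq_mul, Finset.sum_comm]

lemma card_arcs_zero : (Pl.arcs 0).card = 1 := by
  rw [Finset.card_eq_one]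
  refine ⟨Fin.elim0, ?_⟩
  ext p
  simp only [mem_arcs, Finset.mem_singleton]
  exact ⟨fun _ => Subsingleton.elim _ _, fun _ => ⟨fun i => i.elim0, fun i => i.elim0⟩⟩

lemma matchings_eq_empty {n k : ℕ} (h : n < 2 * k) : matchings n k = ∅ := by
  rw [Finset.eq_empty_iff_forall_notMem]
  intro T hT
  obtain ⟨hT, hd⟩ := Finset.mem_filter.1 hT
  obtain ⟨hs, hc⟩ := Finset.mem_powersetCard.1 hT
  have h1 : (T.biUnion id).card = ∑ e ∈ T, e.card := Finset.card_biUnion hd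
  rw [Finset.sum_const_nat (m := 2) fun e he => (Finset.mem_powersetCard.1 (hs he)).2] at h1
  have := Finset.card_le_univ (T.biUnion id)
  rw [Fintype.card_fin] at this
  omega

lemma card_arcs_four : ((Pl.arcs 4).card : ℤ) =
    ((q : ℤ) ^ 2 + q + 1) * ((q : ℤ) ^ 2 + q) * (q : ℤ) ^ 2 * ((q : ℤ) - 1) ^ 2 := by
  rw [card_arcs_succ (by norm_num), card_arcs_succ (by norm_num), card_arcs_succ (by norm_num),
    card_arcs_succ (by norm_num), card_arcs_zero]
  simp only [matchings_eq_empty (n := 0) (k := 2) (by norm_num),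
    matchings_eq_empty (n := 1) (k := 2) (by norm_num),
    matchings_eq_empty (n := 2) (k := 2) (by norm_num),
    matchings_eq_empty (n := 3) (k := 2) (by norm_num),
    matchings_eq_empty (n := 0) (k := 3) (by norm_num),
    matchings_eq_empty (n := 1) (k := 3) (by norm_num),
    matchings_eq_empty (n := 2) (k := 3) (by norm_num),
    matchings_eq_empty (n := 3) (k := 3) (by norm_num),
    show Nat.choose 3 2 = 3 from rfl, Nat.choose_self, Finset.sum_empty, Finset.card_empty]
  norm_num
  ring

lemma card_matchings_four_two : (matchings 4 2).card = 3 := by decide +kernel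

lemma card_matchings_five_two : (matchings 5 2).card = 15 := by decide +kernel

lemma card_matchings_six_two : (matchings 6 2).card = 45 := by decide +kernel

lemma card_matchings_six_three : (matchings 6 3).card = 15 := by decide +kernel

lemma card_arcs_five :
    ((Pl.arcs 5).card : ℤ) = (Pl.arcs 4).card * (((q : ℤ) - 2) * (q - 3)) := by
  rw [card_arcs_succ (by norm_num), matchings_eq_empty (n := 4) (k := 3) (by norm_num),
    card_matchings_four_two, Finset.sum_empty, show Nat.choose 4 2 = 6 from rfl]
  push_cast
  ring

lemma card_arcs_six :
    ((Pl.arcs 6).card : ℤ) = (Pl.arcs 5).card * ((q : ℤ) ^ 2 - 9 * q + 21) := by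
  rw [card_arcs_succ (by norm_num), matchings_eq_empty (n := 5) (k := 3) (by norm_num),
    card_matchings_five_two, Finset.sum_empty, show Nat.choose 5 2 = 10 from rfl]
  push_cast
  ring

/-- The three secants of `p` spanned by consecutive index pairs are concurrent. -/
def Concurrent (p : Fin 6 → Pl.Point) : Prop :=
  ∃ x, x ∈ Pl.join (p 0) (p 1) ∧ x ∈ Pl.join (p 2) (p 3) ∧ x ∈ Pl.join (p 4) (p 5)

/-- The last point lies on the line through the diagonal points `01 ∩ 23` and `02 ∩ 13`. -/
def OnDiagonal (p : Fin 5 → Pl.Point) : Prop :=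
  ∃ x y, x ∈ Pl.join (p 0) (p 1) ∧ x ∈ Pl.join (p 2) (p 3) ∧
    y ∈ Pl.join (p 0) (p 2) ∧ y ∈ Pl.join (p 1) (p 3) ∧ p 4 ∈ Pl.join x y

/-- The last point lies on the line through the diagonal points `01 ∩ 23` and `03 ∩ 12`. -/
def OnDiagonal' (p : Fin 5 → Pl.Point) : Prop :=
  ∃ x y, x ∈ Pl.join (p 0) (p 1) ∧ x ∈ Pl.join (p 2) (p 3) ∧
    y ∈ Pl.join (p 0) (p 3) ∧ y ∈ Pl.join (p 1) (p 2) ∧ p 4 ∈ Pl.join x y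

lemma ne_of_mem_join {a x y : Pl.Point} (h : a ∈ Pl.join x y) : x ≠ y := by
  rintro rfl
  simp [join] at h

lemma card_filter_concurrent_le {T : Finset (Finset (Fin 6))} (hT : T ∈ matchings 6 3) :
    ((Pl.arcs 6).filter Concurrent).card ≤ ∑ p ∈ Pl.arcs 6, (common p T).card := by
  obtain ⟨hT, hd⟩ := Finset.mem_filter.1 hT
  obtain ⟨hs, hc⟩ := Finset.mem_powersetCard.1 hT
  obtain ⟨u, v, w, huv, huw, hvw, rfl⟩ := Finset.card_eq_three.1 hc
  obtain ⟨a, b, hab, rfl⟩ := Finset.card_eq_two.1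
    (Finset.mem_powersetCard.1 (hs (show u ∈ _ by simp))).2
  obtain ⟨c, d, hcd, rfl⟩ := Finset.card_eq_two.1
    (Finset.mem_powersetCard.1 (hs (show v ∈ _ by simp))).2
  obtain ⟨e, f, hef, rfl⟩ := Finset.card_eq_two.1
    (Finset.mem_powersetCard.1 (hs (show w ∈ _ by simp))).2
  have h1 := hd _ (by simp) _ (by simp) huv
  have h2 := hd _ (by simp) _ (by simp) huw
  have h3 := hd _ (by simp) _ (by simp) hvw
  simp only [Finset.disjoint_insert_left, Finset.mem_insert, Finset.mem_singleton,
    Finset.disjoint_singleton_left, not_or] at h1 h2 h3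
  have hinj : Function.Injective ![a, b, c, d, e, f] := by
    intro i j hij
    fin_cases i <;> fin_cases j <;> simp at hij ⊢ <;> simp_all
  let σ : Fin 6 ≃ Fin 6 := Equiv.ofBijective _ (Finite.injective_iff_bijective.1 hinj)
  have hσ : ∀ (p : Fin 6 → Pl.Point) i, (p ∘ σ.symm) (![a, b, c, d, e, f] i) = p i := fun p i =>
    congrArg p (σ.symm_apply_apply i)
  have h4 : ((Pl.arcs 6).filter Concurrent).card ≤
      ((Pl.arcs 6).filter fun p => 0 < (common p {{a, b}, {c, d}, {e, f}}).card).card := by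
    refine Finset.card_le_card_of_injOn (fun p => p ∘ σ.symm) ?_
      (σ.symm.surjective.injective_comp_right.injOn)
    intro p hp
    obtain ⟨hp, x, hx1, hx2, hx3⟩ := Finset.mem_filter.1 hp
    rw [mem_arcs] at hp
    refine Finset.mem_filter.2 ⟨mem_arcs.2 (hp.comp σ.symm.injective),
      Finset.card_pos.2 ⟨x, Finset.mem_filter.2 ⟨Finset.mem_univ _, ?_, ?_⟩⟩⟩
    · have : ∀ i, x ≠ p i := by
        intro i hi
        subst hi
        by_cases hi : i = 0 ∨ i = 1
        · exact hp.2 2 3 i (by decide) (by omega) (by omega) hx2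
        · push Not at hi
          exact hp.2 0 1 i (by decide) hi.1.symm hi.2.symm hx1
      exact fun i => this _
    · have := hσ p
      simp only [Finset.mem_insert, Finset.mem_singleton, forall_eq_or_imp, forall_eq,
        onSecant_pair hab, onSecant_pair hcd, onSecant_pair hef]
      rw [← this 0, ← this 1] at hx1
      rw [← this 2, ← this 3] at hx2
      rw [← this 4, ← this 5] at hx3
      exact ⟨hx1, hx2, hx3⟩
  refine h4.trans ?_
  rw [Finset.card_filter]
  refine Finset.sum_le_sum fun p _ => ?_
  split_ifs <;> omega

lemma exists_common {n : ℕ} {p : Fin n → Pl.Point} (hp : IsArc p) {ℓ : Set Pl.Point}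
    (hℓ : ℓ ∈ Pl.L) (hne : ∀ i j, i ≠ j → Pl.join (p i) (p j) ≠ ℓ) :
    ∃ w : Fin n → Fin n → Pl.Point, ∀ i j, i ≠ j → ∀ c, c ∈ ℓ →
      (c ∈ Pl.join (p i) (p j) ↔ c = w i j) := by
  have : ∀ i j, ∃ w, i ≠ j → ∀ c, c ∈ ℓ → (c ∈ Pl.join (p i) (p j) ↔ c = w) := by
    intro i j
    by_cases hij : i = j
    · exact ⟨p i, fun h => absurd hij h⟩
    · have h := (join_spec (hp.1.ne hij)).1
      obtain ⟨w, ⟨h1, h2⟩, -⟩ := Pl.unique_point _ _ h hℓ (hne i j hij)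
      refine ⟨w, fun _ c hc => ⟨fun hm => ?_, fun hm => hm ▸ h1⟩⟩
      exact eq_of_mem_of_mem h hℓ (hne i j hij) hm hc h1 h2
  choose w hw using this
  exact ⟨w, hw⟩

lemma le_card_extensions {n : ℕ} (hn : 2 ≤ n) {p : Fin n → Pl.Point} (hp : IsArc p)
    {ℓ : Set Pl.Point} (hℓ : ℓ ∈ Pl.L) {w : Fin n → Fin n → Pl.Point}
    (hw : ∀ i j, i ≠ j → ∀ c, c ∈ ℓ → (c ∈ Pl.join (p i) (p j) ↔ c = w i j))
    {E : Finset Pl.Point} (hE : ∀ i j, i < j → w i j ∈ E)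
    {Q : (Fin (n + 1) → Pl.Point) → Prop}
    (hQ : ∀ c ∈ ℓ, c ∉ E → Q (Fin.snoc p c : Fin (n + 1) → Pl.Point)) :
    q + 1 ≤ E.card + (Finset.univ.filter fun x => IsArc (Fin.snoc p x : Fin (n + 1) → Pl.Point) ∧
        Q (Fin.snoc p x : Fin (n + 1) → Pl.Point)).card := by
  have : Nontrivial (Fin n) := Fin.nontrivial_iff_two_le.2 hn
  rw [← card_filter_mem hℓ]
  have h := Finset.le_card_sdiff E (Finset.univ.filter (· ∈ ℓ))
  have h' : (Finset.univ.filter (· ∈ ℓ)) \ E ⊆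
      Finset.univ.filter fun x => IsArc (Fin.snoc p x : Fin (n + 1) → Pl.Point) ∧
        Q (Fin.snoc p x : Fin (n + 1) → Pl.Point) := by
    intro c hc
    simp only [Finset.mem_sdiff, Finset.mem_filter, Finset.mem_univ, true_and] at hc ⊢
    have h2 : ∀ i j, i < j → c ∉ Pl.join (p i) (p j) := fun i j hij hm =>
      hc.2 ((hw i j hij.ne c hc.1).1 hm ▸ hE i j hij)
    refine ⟨isArc_snoc hp (fun i hi => ?_) h2, hQ c hc.1 hc.2⟩
    obtain ⟨j, hj⟩ := exists_ne i
    have h3 := join_spec (hp.1.ne hj)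
    rcases lt_or_gt_of_ne hj with hl | hl
    · exact h2 j i hl (hi ▸ h3.2.2)
    · exact h2 i j hl (by rw [join_comm]; exact hi ▸ h3.2.2)
  have := Finset.card_le_card h'
  omega

lemma le_card_concurrent {p : Fin 5 → Pl.Point} (hp : IsArc p) :
    (q : ℤ) - 5 + (if OnDiagonal p then 1 else 0) + (if OnDiagonal' p then 1 else 0) ≤
      (Finset.univ.filter fun x => IsArc (Fin.snoc p x : Fin 6 → Pl.Point) ∧
        Concurrent (Fin.snoc p x : Fin 6 → Pl.Point)).card := by
  have hij : ∀ i j, i ≠ j → Pl.join (p i) (p j) ∈ Pl.L ∧ p i ∈ Pl.join (p i) (p j) ∧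
    p j ∈ Pl.join (p i) (p j) := fun i j h => join_spec (hp.1.ne h)
  have h01 := hij 0 1 (by decide)
  have h23 := hij 2 3 (by decide)
  have hne := hp.join_ne (show (0 : Fin 5) ≠ 1 by decide) (show (0 : Fin 5) ≠ 3 by decide)
    (show (1 : Fin 5) ≠ 3 by decide) (show (2 : Fin 5) ≠ 3 by decide)
  obtain ⟨x, ⟨hx1, hx2⟩, -⟩ := Pl.unique_point _ _ h01.1 h23.1 hne
  have huniq : ∀ y, y ∈ Pl.join (p 0) (p 1) → y ∈ Pl.join (p 2) (p 3) → y = x :=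
    fun y h1 h2 => eq_of_mem_of_mem h01.1 h23.1 hne h1 h2 hx1 hx2
  have hx4 : x ≠ p 4 := by
    rintro rfl
    exact hp.2 0 1 4 (by decide) (by decide) (by decide) hx1
  obtain ⟨hℓ, hxℓ, h4ℓ⟩ := join_spec hx4
  have hmiss : ∀ k, k ≠ 4 → p k ∉ Pl.join x (p 4) := by
    intro k hk hm
    by_cases hk' : k = 0 ∨ k = 1
    · have hxk : x ≠ p k := by
        rintro rfl
        exact hp.2 2 3 k (by decide) (by omega) (by omega) hx2
      have h : p k ∈ Pl.join (p 0) (p 1) := by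
        rcases hk' with rfl | rfl
        exacts [h01.2.1, h01.2.2]
      rw [eq_of_mem hxk hℓ h01.1 hxℓ hm hx1 h] at h4ℓ
      exact hp.2 0 1 4 (by decide) (by decide) (by decide) h4ℓ
    · have hxk : x ≠ p k := by
        rintro rfl
        exact hp.2 0 1 k (by decide) (by omega) (by omega) hx1
      have h : p k ∈ Pl.join (p 2) (p 3) := by
        obtain rfl | rfl : k = 2 ∨ k = 3 := by omega
        exacts [h23.2.1, h23.2.2]
      rw [eq_of_mem hxk hℓ h23.1 hxℓ hm hx2 h] at h4ℓ
      exact hp.2 2 3 4 (by decide) (by decide) (by decide) h4ℓ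
  have hneℓ : ∀ i j, i ≠ j → Pl.join (p i) (p j) ≠ Pl.join x (p 4) := by
    intro i j h he
    have := hij i j h
    rw [he] at this
    by_cases hi : i = 4
    · exact hmiss j (fun hj => h (hi.trans hj.symm)) this.2.2
    · exact hmiss i hi this.2.1
  obtain ⟨w, hw⟩ := exists_common hp hℓ hneℓ
  have hw4 : ∀ i, i ≠ 4 → w i 4 = p 4 := fun i hi =>
    ((hw i 4 hi _ h4ℓ).1 (hij i 4 hi).2.2).symm
  have hw01 : w 0 1 = x := ((hw 0 1 (by decide) _ hxℓ).1 hx1).symm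
  have hw23 : w 2 3 = x := ((hw 2 3 (by decide) _ hxℓ).1 hx2).symm
  have hdiag : ∀ i j k l : Fin 5, i ≠ j → k ≠ l → ∀ x' y, x' ∈ Pl.join (p 0) (p 1) →
      x' ∈ Pl.join (p 2) (p 3) → y ∈ Pl.join (p i) (p j) → y ∈ Pl.join (p k) (p l) →
      p 4 ∈ Pl.join x' y → w i j = w k l := by
    intro i j k l hij hkl x' y h1 h2 h3 h4 h5
    obtain rfl := huniq x' h1 h2
    have h6 := join_spec (ne_of_mem_join h5)
    have hy : y ∈ Pl.join x' (p 4) := eq_join hx4 h6.1 h6.2.1 h5 ▸ h6.2.2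
    rw [← (hw i j hij y hy).1 h3, ← (hw k l hkl y hy).1 h4]
  have hY : OnDiagonal p → w 0 2 = w 1 3 := by
    rintro ⟨x', y, h1, h2, h3, h4, h5⟩
    exact hdiag 0 2 1 3 (by decide) (by decide) x' y h1 h2 h3 h4 h5
  have hZ : OnDiagonal' p → w 0 3 = w 1 2 := by
    rintro ⟨x', y, h1, h2, h3, h4, h5⟩
    exact hdiag 0 3 1 2 (by decide) (by decide) x' y h1 h2 h3 h4 h5
  have hE : ∀ i j, i < j → w i j ∈ ({x, p 4, w 0 2, w 1 3, w 0 3, w 1 2} : Finset Pl.Point) := by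
    intro i j hlt
    by_cases hj : j = 4
    · subst hj
      simp [hw4 i hlt.ne]
    · obtain ⟨rfl, rfl⟩ | ⟨rfl, rfl⟩ | ⟨rfl, rfl⟩ | ⟨rfl, rfl⟩ | ⟨rfl, rfl⟩ | ⟨rfl, rfl⟩ :
        (i = 0 ∧ j = 1) ∨ (i = 2 ∧ j = 3) ∨ (i = 0 ∧ j = 2) ∨ (i = 1 ∧ j = 3) ∨
          (i = 0 ∧ j = 3) ∨ (i = 1 ∧ j = 2) := by omega
      all_goals simp [hw01, hw23]
  have hmain := le_card_extensions (by norm_num) hp hℓ hw hE (Q := Concurrent) (by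
    intro c hc hcE
    have h4c : p 4 ≠ c := by
      rintro rfl
      simp at hcE
    refine ⟨x, hx1, hx2, ?_⟩
    change x ∈ Pl.join (p 4) c
    rw [← eq_join h4c hℓ h4ℓ hc]
    exact hxℓ)
  have hcard : ({x, p 4, w 0 2, w 1 3, w 0 3, w 1 2} : Finset Pl.Point).card
      + (if OnDiagonal p then 1 else 0) + (if OnDiagonal' p then 1 else 0) ≤ 6 := by
    split_ifs with h1 h2 h2
    · have := Finset.card_le_four (a := x) (b := p 4) (c := w 1 3) (d := w 1 2)
      rw [hY h1, hZ h2]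
      simp only [Finset.pair_eq_singleton, Finset.insert_idem]
      omega
    · have := Finset.card_le_five (a := x) (b := p 4) (c := w 1 3) (d := w 0 3) (e := w 1 2)
      rw [hY h1]
      simp only [Finset.insert_idem]
      omega
    · have := Finset.card_le_five (a := x) (b := p 4) (c := w 0 2) (d := w 1 3) (e := w 1 2)
      rw [hZ h2]
      simp only [Finset.pair_eq_singleton]
      omega
    · exact Finset.card_le_six
  zify at hmain hcard
  push_cast at hmain hcard
  linarith

lemma le_card_onDiagonal_extensions {p : Fin 4 → Pl.Point} (hp : IsArc p) :
    (q : ℤ) - 3 ≤ (Finset.univ.filter fun x => IsArc (Fin.snoc p x : Fin 5 → Pl.Point) ∧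
        OnDiagonal (Fin.snoc p x : Fin 5 → Pl.Point)).card := by
  have hij : ∀ i j, i ≠ j → Pl.join (p i) (p j) ∈ Pl.L ∧ p i ∈ Pl.join (p i) (p j) ∧
    p j ∈ Pl.join (p i) (p j) := fun i j h => join_spec (hp.1.ne h)
  have h01 := hij 0 1 (by decide)
  have h23 := hij 2 3 (by decide)
  have h02 := hij 0 2 (by decide)
  have h13 := hij 1 3 (by decide)
  obtain ⟨x, ⟨hx1, hx2⟩, -⟩ := Pl.unique_point _ _ h01.1 h23.1
    (hp.join_ne (by decide) (by decide) (by decide) (by decide))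
  obtain ⟨y, ⟨hy1, hy2⟩, -⟩ := Pl.unique_point _ _ h02.1 h13.1
    (hp.join_ne (by decide) (by decide) (by decide) (by decide))
  have hxp : ∀ k, x ≠ p k := by
    rintro k rfl
    by_cases hk : k = 0 ∨ k = 1
    · exact hp.2 2 3 k (by decide) (by omega) (by omega) hx2
    · exact hp.2 0 1 k (by decide) (by omega) (by omega) hx1
  have hyp : ∀ k, y ≠ p k := by
    rintro k rfl
    by_cases hk : k = 0 ∨ k = 2
    · exact hp.2 1 3 k (by decide) (by omega) (by omega) hy2
    · exact hp.2 0 2 k (by decide) (by omega) (by omega) hy1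
  have hxy : x ≠ y := by
    rintro rfl
    have := eq_of_mem (hxp 0) h01.1 h02.1 hx1 h01.2.1 hy1 h02.2.1
    exact hp.join_ne (by decide) (by decide) (by decide) (by decide) this
  obtain ⟨hℓ, hxℓ, hyℓ⟩ := join_spec hxy
  have hmiss : ∀ k, p k ∉ Pl.join x y := by
    intro k hm
    have h1 : ∀ m ∈ Pl.L, x ∈ m → p k ∈ m → Pl.join x y = m := fun m hm' h h' =>
      eq_of_mem (hxp k) hℓ hm' hxℓ hm h h'
    have h2 : ∀ m ∈ Pl.L, y ∈ m → p k ∈ m → Pl.join x y = m := fun m hm' h h' =>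
      eq_of_mem (hyp k) hℓ hm' hyℓ hm h h'
    obtain rfl | rfl | rfl | rfl : k = 0 ∨ k = 1 ∨ k = 2 ∨ k = 3 := by omega
    · exact hp.join_ne (by decide) (by decide) (by decide) (by decide)
        ((h1 _ h01.1 hx1 h01.2.1).symm.trans (h2 _ h02.1 hy1 h02.2.1))
    · exact hp.join_ne (by decide) (by decide) (by decide) (by decide)
        ((h1 _ h01.1 hx1 h01.2.2).symm.trans (h2 _ h13.1 hy2 h13.2.1))
    · exact hp.join_ne (by decide) (by decide) (by decide) (by decide)
        ((h2 _ h02.1 hy1 h02.2.2).symm.trans (h1 _ h23.1 hx2 h23.2.1))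
    · refine hp.2 2 3 1 (by decide) (by decide) (by decide) ?_
      rw [← h1 _ h23.1 hx2 h23.2.2, h2 _ h13.1 hy2 h13.2.2]
      exact h13.2.1
  obtain ⟨w, hw⟩ := exists_common hp hℓ fun i j h he => hmiss i (he ▸ (hij i j h).2.1)
  have hw01 : w 0 1 = x := ((hw 0 1 (by decide) _ hxℓ).1 hx1).symm
  have hw23 : w 2 3 = x := ((hw 2 3 (by decide) _ hxℓ).1 hx2).symm
  have hw02 : w 0 2 = y := ((hw 0 2 (by decide) _ hyℓ).1 hy1).symm
  have hw13 : w 1 3 = y := ((hw 1 3 (by decide) _ hyℓ).1 hy2).symm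
  have hE : ∀ i j, i < j → w i j ∈ ({x, y, w 0 3, w 1 2} : Finset Pl.Point) := by
    intro i j hlt
    obtain ⟨rfl, rfl⟩ | ⟨rfl, rfl⟩ | ⟨rfl, rfl⟩ | ⟨rfl, rfl⟩ | ⟨rfl, rfl⟩ | ⟨rfl, rfl⟩ :
      (i = 0 ∧ j = 1) ∨ (i = 2 ∧ j = 3) ∨ (i = 0 ∧ j = 2) ∨ (i = 1 ∧ j = 3) ∨
        (i = 0 ∧ j = 3) ∨ (i = 1 ∧ j = 2) := by omega
    all_goals simp [hw01, hw23, hw02, hw13]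
  have hmain := le_card_extensions (by norm_num) hp hℓ hw hE (Q := OnDiagonal)
    fun c hc _ => ⟨x, y, hx1, hx2, hy1, hy2, hc⟩
  have hcard : ({x, y, w 0 3, w 1 2} : Finset Pl.Point).card ≤ 4 := Finset.card_le_four
  omega

lemma le_card_filter_onDiagonal :
    ((Pl.arcs 4).card : ℤ) * (q - 3) ≤ ((Pl.arcs 5).filter OnDiagonal).card := by
  rw [card_filter_arcs_succ, ← nsmul_eq_mul, ← Finset.sum_const, Nat.cast_sum]
  exact Finset.sum_le_sum fun p hp => le_card_onDiagonal_extensions (mem_arcs.1 hp)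

lemma card_filter_onDiagonal' :
    ((Pl.arcs 5).filter OnDiagonal').card = ((Pl.arcs 5).filter OnDiagonal).card := by
  have hs : ∀ r : Fin 5 → Pl.Point, (r ∘ Equiv.swap 0 1) ∘ Equiv.swap 0 1 = r := fun r => by
    ext i
    simp
  refine Finset.card_nbij' (fun r => r ∘ Equiv.swap 0 1) (fun r => r ∘ Equiv.swap 0 1) ?_ ?_
    (fun r _ => hs r) (fun r _ => hs r)
  · intro r hr
    obtain ⟨hr, x, y, h1, h2, h3, h4, h5⟩ := Finset.mem_filter.1 hr
    refine Finset.mem_filter.2 ⟨mem_arcs.2 ((mem_arcs.1 hr).comp (Equiv.injective _)),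
      x, y, ?_, h2, h4, h3, h5⟩
    rw [join_comm]
    exact h1
  · intro r hr
    obtain ⟨hr, x, y, h1, h2, h3, h4, h5⟩ := Finset.mem_filter.1 hr
    refine Finset.mem_filter.2 ⟨mem_arcs.2 ((mem_arcs.1 hr).comp (Equiv.injective _)),
      x, y, ?_, h2, h4, h3, h5⟩
    rw [join_comm]
    exact h1

lemma le_card_filter_concurrent :
    ((Pl.arcs 4).card : ℤ) * ((q - 3) ^ 2 * (q - 4)) ≤ ((Pl.arcs 6).filter Concurrent).card := by
  have h : ((Pl.arcs 5).card : ℤ) * (q - 5) + ((Pl.arcs 5).filter OnDiagonal).card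
      + ((Pl.arcs 5).filter OnDiagonal').card ≤ ((Pl.arcs 6).filter Concurrent).card := by
    rw [card_filter_arcs_succ 5, ← nsmul_eq_mul, ← Finset.sum_const, Nat.cast_sum,
      Finset.card_filter OnDiagonal, Finset.card_filter OnDiagonal']
    push_cast
    rw [← Finset.sum_add_distrib, ← Finset.sum_add_distrib]
    exact Finset.sum_le_sum fun p hp => le_card_concurrent (mem_arcs.1 hp)
  rw [card_filter_onDiagonal', card_arcs_five] at h
  linarith [le_card_filter_onDiagonal (Pl := Pl)]

lemma card_arcs_seven_le : ((Pl.arcs 7).card : ℤ) ≤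
    (Pl.arcs 6).card * ((q : ℤ) ^ 2 - 14 * q + 55) -
      15 * ((Pl.arcs 4).card * ((q - 3) ^ 2 * (q - 4))) := by
  have h : (matchings 6 3).card • ((Pl.arcs 4).card * ((q - 3) ^ 2 * (q - 4)) : ℤ) ≤
      ∑ T ∈ matchings 6 3, ∑ p ∈ Pl.arcs 6, ((common p T).card : ℤ) := by
    refine Finset.card_nsmul_le_sum _ _ _ fun T hT => ?_
    refine le_card_filter_concurrent.trans ?_
    exact_mod_cast card_filter_concurrent_le hT
  rw [card_matchings_six_three, nsmul_eq_mul] at h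
  rw [card_arcs_succ (by norm_num), card_matchings_six_two, show Nat.choose 6 2 = 15 from rfl]
  push_cast at h ⊢
  linarith

end ProjPlane

/-- The number of ordered 7-arcs in any finite projective plane of order `q`
is at most the value of Glynn's degree-14 polynomial. -/
theorem seven_arcs_le (q : ℕ) (Pl : ProjPlane q) :
    (Pl.nArcs 7 : ℤ) ≤
      ((q : ℤ) ^ 2 + q + 1) * ((q : ℤ) ^ 2 + q) * (q : ℤ) ^ 2 * ((q : ℤ) - 1) ^ 2 *
        ((q : ℤ) - 3) * ((q : ℤ) - 5) *
        ((q : ℤ) ^ 4 - 20 * q ^ 3 + 148 * (q : ℤ) ^ 2 - 468 * q + 498) := by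
  rw [ProjPlane.nArcs_eq]
  refine ProjPlane.card_arcs_seven_le.trans (le_of_eq ?_)
  rw [ProjPlane.card_arcs_six, ProjPlane.card_arcs_five, ProjPlane.card_arcs_four]
  ring
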